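/- Let S be a finite nonempty set, let p₁, p₂ : S → ℝ satisfy ∑_{x∈S} p₁(x) = ∑_{x∈S} p₂(x) = 1 and |p₁(x) − p₂(x)| ≤ δ_P for every x ∈ S, and let Φ be a feature matrix whose bias feature is constantly 1 and whose every non-bias feature i satisfies ∑_{x∈S} |Φ_i(x)| ≤ 1. Then for any w ∈ ℝ^k with ‖w‖_{-1} ≤ ψ, |∑_{x∈S} p₁(x)(Φw)(x) − ∑_{x∈S} p₂(x)(Φw)(x)| ≤ δ_P · ψ. -/

import Mathlib

open Finset

/-- `(Φ w)(s) = ∑ i, Φ_i(s) w_i`. -/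
def phiW {S : Type*} [Fintype S] {k : ℕ} (Φ : S → Fin (k + 1) → ℝ) (w : Fin (k + 1) → ℝ)
    (s : S) : ℝ :=
  ∑ i, Φ s i * w i

/-- `‖w‖_{-1}`: the ℓ¹ norm of `w` with the bias coordinate (index 0) excluded. -/
def normNeg1 {k : ℕ} (w : Fin (k + 1) → ℝ) : ℝ :=
  ∑ i ∈ Finset.univ.erase 0, |w i|

/-- two distributions within `δ_P` of one another give expected feature
values within `δ_P ψ`, for normalized features with a bias feature. -/
theorem statement_12 {S : Type*} [Fintype S] [Nonempty S]
    (p₁ p₂ : S → ℝ) (δP : ℝ)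
    (h₁ : ∑ x, p₁ x = 1) (h₂ : ∑ x, p₂ x = 1)
    (hδ : ∀ x, |p₁ x - p₂ x| ≤ δP)
    {k : ℕ} (Φ : S → Fin (k + 1) → ℝ) (hbias : ∀ x, Φ x 0 = 1)
    (hΦnorm : ∀ i : Fin (k + 1), i ≠ 0 → ∑ x, |Φ x i| ≤ 1)
    (ψ : ℝ) (w : Fin (k + 1) → ℝ) (hw : normNeg1 w ≤ ψ) :
    |(∑ x, p₁ x * phiW Φ w x) - ∑ x, p₂ x * phiW Φ w x| ≤ δP * ψ := by
  have hδ0 : 0 ≤ δP := (abs_nonneg _).trans (hδ (Classical.arbitrary S))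
  have hswap : (∑ x, p₁ x * phiW Φ w x) - ∑ x, p₂ x * phiW Φ w x
      = ∑ i, (∑ x, (p₁ x - p₂ x) * Φ x i) * w i := by
    simp only [phiW, ← Finset.sum_sub_distrib, ← sub_mul, Finset.mul_sum, Finset.sum_mul]
    rw [Finset.sum_comm]
    simp only [mul_assoc]
  have hzero : (∑ x, (p₁ x - p₂ x) * Φ x 0) * w 0 = 0 := by
    simp [hbias, Finset.sum_sub_distrib, h₁, h₂]
  have hfeature : ∀ i : Fin (k + 1), i ≠ 0 → |∑ x, (p₁ x - p₂ x) * Φ x i| ≤ δP := by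
    intro i hi
    calc |∑ x, (p₁ x - p₂ x) * Φ x i|
        ≤ ∑ x, |(p₁ x - p₂ x) * Φ x i| := Finset.abs_sum_le_sum_abs _ _
      _ ≤ ∑ x, δP * |Φ x i| := Finset.sum_le_sum fun x _ => by
          rw [abs_mul]
          exact mul_le_mul_of_nonneg_right (hδ x) (abs_nonneg _)
      _ = δP * ∑ x, |Φ x i| := (Finset.mul_sum _ _ _).symm
      _ ≤ δP := mul_le_of_le_one_right hδ0 (hΦnorm i hi)
  rw [hswap, ← Finset.add_sum_erase _ _ (Finset.mem_univ 0), hzero, zero_add]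
  calc |∑ i ∈ Finset.univ.erase 0, (∑ x, (p₁ x - p₂ x) * Φ x i) * w i|
      ≤ ∑ i ∈ Finset.univ.erase 0, |(∑ x, (p₁ x - p₂ x) * Φ x i) * w i| :=
        Finset.abs_sum_le_sum_abs _ _
    _ ≤ ∑ i ∈ Finset.univ.erase 0, δP * |w i| := Finset.sum_le_sum fun i hi => by
        rw [abs_mul]
        exact mul_le_mul_of_nonneg_right (hfeature i (Finset.ne_of_mem_erase hi)) (abs_nonneg _)
    _ = δP * normNeg1 w := (Finset.mul_sum _ _ _).symm
    _ ≤ δP * ψ := mul_le_mul_of_nonneg_left hw hδ0
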